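/- For every integer m ≥ 1000, the quantity ι₂ = φ(m) + ln(1 + 2η/m) satisfies ι₂ ≤ 6/m; in particular ι₂ = O(1/m) as m → ∞ (here m plays the role of dL in the binomial-dictionary error bound). -/

import Mathlib

/-- `c_ζ = 1/(1+2ζ)² + 1/(1−2ζ)²`. -/
noncomputable def cZeta (ζ : ℝ) : ℝ := 1 / (1 + 2 * ζ) ^ 2 + 1 / (1 - 2 * ζ) ^ 2

/-- `φ_ζ(l)`, the maximum of the three expressions from Takeishi et al. -/
noncomputable def phiZeta (ζ l : ℝ) : ℝ :=
  max (((3 / 16) * (cZeta ζ) ^ 2 + 1 / 12) / l)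
    (max (-(4 * ζ ^ 4 / 3) * l + Real.log (l / 2) + 1 / (12 * l))
      (-(Real.log 2 - 1 / 2) * l + (1 / 2) * Real.log (Real.pi * l / 2)))

/-- `φ(l) = inf_{ζ ∈ (0,1/2)} φ_ζ(l)`. -/
noncomputable def phi (l : ℝ) : ℝ := ⨅ ζ : Set.Ioo (0 : ℝ) (1 / 2), phiZeta ζ l

/-- `η = √(9/(8πe))`. -/
noncomputable def eta : ℝ := Real.sqrt (9 / (8 * Real.pi * Real.exp 1))

theorem phiZeta_nonneg {ζ l : ℝ} (hl : 0 ≤ l) : 0 ≤ phiZeta ζ l :=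
  le_max_of_le_left (by positivity)

theorem phi_nonneg {l : ℝ} (hl : 0 ≤ l) : 0 ≤ phi l :=
  Real.iInf_nonneg fun _ => phiZeta_nonneg hl

theorem phi_le_phiZeta {ζ l : ℝ} (hl : 0 ≤ l) (hζ : ζ ∈ Set.Ioo (0 : ℝ) (1 / 2)) :
    phi l ≤ phiZeta ζ l :=
  ciInf_le (f := fun ζ : Set.Ioo (0 : ℝ) (1 / 2) => phiZeta ζ l)
    ⟨0, by rintro _ ⟨_, rfl⟩; exact phiZeta_nonneg hl⟩ ⟨ζ, hζ⟩

theorem eta_nonneg : 0 ≤ eta := Real.sqrt_nonneg _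

theorem eta_le : eta ≤ 0.37 := by
  refine Real.sqrt_le_iff.2 ⟨by norm_num, ?_⟩
  have hπ := Real.pi_gt_d2
  have he := Real.exp_one_gt_d9
  rw [div_le_iff₀ (by positivity)]
  nlinarith [mul_le_mul hπ.le he.le (by norm_num) Real.pi_pos.le]

theorem log_half_le {l : ℝ} (hl : 0 < l) : Real.log (l / 2) ≤ 5.24 + l / 1000 := by
  have h500 : Real.log 500 ≤ 6.24 := by
    have h : Real.log 500 ≤ Real.log (2 ^ 9) := Real.log_le_log (by norm_num) (by norm_num)
    rw [Real.log_pow] at h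
    push_cast at h
    linarith [Real.log_two_lt_d9]
  have h : Real.log (l / 2) = Real.log 500 + Real.log (l / 1000) := by
    rw [← Real.log_mul (by norm_num) (by positivity)]
    ring_nf
  linarith [Real.log_le_sub_one_of_pos (show 0 < l / 1000 by positivity)]

theorem log_pi_mul_half_le {l : ℝ} (hl : 0 < l) :
    Real.log (Real.pi * l / 2) ≤ 6.64 + l / 1000 := by
  have h : Real.log (Real.pi * l / 2) ≤ Real.log (2 ^ 2 * (l / 2)) :=
    Real.log_le_log (by positivity) (by nlinarith [Real.pi_le_four])
  rw [Real.log_mul (by norm_num) (by positivity), Real.log_pow] at h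
  push_cast at h
  linarith [log_half_le hl, Real.log_two_lt_d9]

theorem phi_le {l : ℝ} (hl : 1000 ≤ l) : phi l ≤ 5.06 / l := by
  have hl0 : 0 < l := by linarith
  have hdiv : 0 ≤ 5.06 / l := by positivity
  refine (phi_le_phiZeta (ζ := 0.27) hl0.le ⟨by norm_num, by norm_num⟩).trans ?_
  refine max_le ?_ (max_le (le_trans ?_ hdiv) (le_trans ?_ hdiv))
  · gcongr
    norm_num [cZeta]
  · have h : 1 / (12 * l) ≤ 1 / 12000 := one_div_le_one_div_of_le (by norm_num) (by linarith)
    linarith [log_half_le hl0]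
  · nlinarith [log_pi_mul_half_le hl0, Real.log_two_gt_d9]

theorem log_one_add_eta_nonneg {l : ℝ} (hl : 0 ≤ l) : 0 ≤ Real.log (1 + 2 * eta / l) :=
  Real.log_nonneg (le_add_of_nonneg_right (by have := eta_nonneg; positivity))

theorem log_one_add_eta_le {l : ℝ} (hl : 0 < l) : Real.log (1 + 2 * eta / l) ≤ 0.74 / l := by
  have hη := eta_nonneg
  have h := Real.log_le_sub_one_of_pos (show 0 < 1 + 2 * eta / l by positivity)
  have h' : 2 * eta / l ≤ 0.74 / l := by
    gcongr
    linarith [eta_le]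
  linarith

theorem phi_add_log_le {l : ℝ} (hl : 1000 ≤ l) :
    phi l + Real.log (1 + 2 * eta / l) ≤ 6 / l := by
  have hl0 : 0 < l := by linarith
  calc
    phi l + Real.log (1 + 2 * eta / l) ≤ 5.06 / l + 0.74 / l :=
      add_le_add (phi_le hl) (log_one_add_eta_le hl0)
    _ = 5.8 / l := by ring
    _ ≤ 6 / l := by gcongr; norm_num

/-- For every integer `m ≥ 1000`, `ι₂ = φ(m) + ln(1 + 2η/m) ≤ 6/m`;
in particular `ι₂ = O(1/m)` as `m → ∞`. -/
theorem stmt_17 :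
    (∀ m : ℕ, 1000 ≤ m → phi m + Real.log (1 + 2 * eta / m) ≤ 6 / (m : ℝ)) ∧
    (fun m : ℕ => phi m + Real.log (1 + 2 * eta / m)) =O[Filter.atTop]
      (fun m : ℕ => 1 / (m : ℝ)) := by
  have key : ∀ m : ℕ, 1000 ≤ m → phi m + Real.log (1 + 2 * eta / m) ≤ 6 / (m : ℝ) :=
    fun m hm => phi_add_log_le (by exact_mod_cast hm)
  refine ⟨key, Asymptotics.IsBigO.of_bound 6 ?_⟩
  filter_upwards [Filter.eventually_ge_atTop 1000] with m hm
  have hm0 : (0 : ℝ) ≤ m := m.cast_nonneg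
  rw [Real.norm_of_nonneg (add_nonneg (phi_nonneg hm0) (log_one_add_eta_nonneg hm0)),
    Real.norm_of_nonneg (by positivity), mul_one_div]
  exact key m hm
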